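/- arXiv:math/0212408 — 3 statements merged into one kernel-verified Lean document; each statement's English description precedes it below -/
import Mathlib

section
/- Let A be an abelian variety over an algebraically closed field of characteristic zero, F: A → A an isogeny, Z ⊆ A an irreducible closed subvariety, and m ≥ 1 an integer with F^m(Z) = Z. For r ≥ 1 let G_r denote the stabilizer of Z in Ker(F^{rm}) under the translation action of Ker(F^{rm}) on the set of irreducible components of (F^{rm})^{-1}(Z). If |G_1| > 1, then the translation stabilizer Stab_A(Z) = {a ∈ A : a + Z = Z} has positive dimension. -/
universe u

/-- A bare-bones interface for an abelian variety `A` over a field `K`: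
`Pt` is the group `A(K)` of `K`-points, carrying the Zariski topology;
`IsSubvariety S` singles out the subsets of `A(K)` that are the sets of
`K`-points of closed subvarieties of `A`, and `IsAbelianSubvariety B` those
that are the sets of `K`-points of abelian subvarieties of `A`.  A few
standard properties of abelian varieties over an algebraically closed field
are recorded as axioms. -/
structure AbelianVariety (K : Type u) [Field K] where
  /-- the group `A(K)` of `K`-points of `A` -/
  Pt : Type u
  [ptAddCommGroup : AddCommGroup Pt]
  /-- the Zariski topology on `A(K)` -/
  [ptTopology : TopologicalSpace Pt]
  /-- `IsSubvariety S` : `S` is the set of `K`-points of a closed subvariety of `A` -/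
  IsSubvariety : Set Pt → Prop
  isClosed_of_isSubvariety : ∀ S : Set Pt, IsSubvariety S → IsClosed S
  isSubvariety_translate : ∀ (a : Pt) (S : Set Pt), IsSubvariety S →
    IsSubvariety ((fun x => a + x) '' S)
  /-- `IsAbelianSubvariety B` : `B` is the set of `K`-points of an abelian
  subvariety of `A` -/
  IsAbelianSubvariety : Set Pt → Prop
  isSubvariety_of_isAbelianSubvariety : ∀ B : Set Pt, IsAbelianSubvariety B → IsSubvariety B
  isAddSubgroup_of_isAbelianSubvariety : ∀ B : Set Pt, IsAbelianSubvariety B →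
    ∃ H : AddSubgroup Pt, (H : Set Pt) = B
  isAbelianSubvariety_zero : IsAbelianSubvariety ({0} : Set Pt)
  isAbelianSubvariety_univ : IsAbelianSubvariety (Set.univ : Set Pt)
  /-- `A(K)` is divisible (`K` being algebraically closed) -/
  ptDivisible : ∀ n : ℕ, 0 < n → ∀ x : Pt, ∃ y : Pt, n • y = x
  /-- the `n`-torsion of `A(K)` is finite -/
  ptTorsionFinite : ∀ n : ℕ, 0 < n → {x : Pt | n • x = 0}.Finite

attribute [instance] AbelianVariety.ptAddCommGroup AbelianVariety.ptTopology

namespace AbelianVariety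

variable {K : Type u} [Field K]

/-- `S` is the translate, by a point of `A`, of an abelian subvariety of `A`. -/
def IsTranslateOfAbelianSubvariety (A : AbelianVariety K) (S : Set A.Pt) : Prop :=
  ∃ (a : A.Pt) (B : Set A.Pt), A.IsAbelianSubvariety B ∧ S = (fun x => a + x) '' B

end AbelianVariety

namespace AbelianVariety

/-- An algebraic endomorphism of the abelian variety `A`, recorded through its
(additive) action on the points of `A`, together with the fact that, being a
proper morphism, it maps closed subvarieties onto closed subvarieties. -/
structure Hom {K : Type u} [Field K] (A : AbelianVariety K) where
  toFun : A.Pt →+ A.Pt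
  map_isSubvariety : ∀ S : Set A.Pt, A.IsSubvariety S → A.IsSubvariety (toFun '' S)

namespace Hom

variable {K : Type u} [Field K] {A : AbelianVariety K}

/-- the identity endomorphism of `A` -/
def id (A : AbelianVariety K) : A.Hom where
  toFun := AddMonoidHom.id A.Pt
  map_isSubvariety := fun S hS => by simpa using hS

/-- composition of endomorphisms of `A` -/
def comp (f g : A.Hom) : A.Hom where
  toFun := f.toFun.comp g.toFun
  map_isSubvariety := fun S hS => by
    rw [AddMonoidHom.coe_comp, Set.image_comp]
    exact f.map_isSubvariety _ (g.map_isSubvariety _ hS)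

/-- iterates `f^n` of an endomorphism `f` of `A` -/
def pow (f : A.Hom) : ℕ → A.Hom
  | 0 => Hom.id A
  | n + 1 => (f.pow n).comp f

/-- the endomorphism `P(f)` of the group `A(K)`, for an integer polynomial
`P(T) = Σ aᵢ Tⁱ`: it sends `x` to `Σ aᵢ • fⁱ(x)`. -/
def polyApply (f : A.Hom) (P : Polynomial ℤ) (x : A.Pt) : A.Pt :=
  P.sum fun i a => a • (f.pow i).toFun x

/-- an endomorphism of `A` is an isogeny if it is surjective with finite
kernel -/
def IsIsogeny (f : A.Hom) : Prop :=
  Function.Surjective f.toFun ∧ {x : A.Pt | f.toFun x = 0}.Finite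

end Hom

end AbelianVariety

namespace AddMonoidHom

lemma finite_preimage_of_finite_ker {G H : Type*} [AddCommGroup G] [AddCommGroup H] (f : G →+ H)
    (hf : {x | f x = 0}.Finite) {s : Set H} (hs : s.Finite) : (f ⁻¹' s).Finite := by
  refine hs.preimage' fun y _ => ?_
  rcases (f ⁻¹' {y}).eq_empty_or_nonempty with h | ⟨x, hx⟩
  · simp [h]
  · refine (hf.image fun k => k + x).subset fun z hz => ⟨z - x, ?_, by simp⟩
    simp_all

end AddMonoidHom

namespace AbelianVariety.Hom

variable {K : Type u} [Field K] {A : AbelianVariety K}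

lemma IsIsogeny.pow {f : A.Hom} (hf : f.IsIsogeny) (n : ℕ) : (f.pow n).IsIsogeny := by
  induction n with
  | zero =>
    refine ⟨Function.surjective_id, (Set.finite_singleton (0 : A.Pt)).subset fun x hx => hx⟩
  | succ n ih => exact ⟨ih.1.comp hf.1, f.toFun.finite_preimage_of_finite_ker hf.2 ih.2⟩

/-- If `f(Z) = Z` for an irreducible subvariety `Z`, then a translate of `Z` mapped by `f` into `Z`
is contained in a translate of `Z` by a point of the kernel of `f`. -/
lemma IsIsogeny.exists_ker_translate_subset {f : A.Hom} (hf : f.IsIsogeny) {Z : Set A.Pt}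
    (hZ : A.IsSubvariety Z) (hirr : IsIrreducible Z) (hfZ : f.toFun '' Z = Z) {a : A.Pt}
    (ha : ∀ z ∈ Z, f.toFun a + z ∈ Z) :
    ∃ b, f.toFun b = f.toFun a ∧ ∀ z ∈ Z, b + z ∈ Z := by
  classical
  obtain ⟨w, hw, hZw⟩ := isIrreducible_iff_sUnion_isClosed.1 hirr
    (hf.2.toFinset.image fun k => (fun x => (k - a) + x) '' Z)
    (by
      intro w hw
      obtain ⟨k, -, rfl⟩ := Finset.mem_image.1 hw
      exact A.isClosed_of_isSubvariety _ (A.isSubvariety_translate _ _ hZ))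
    (by
      intro z hz
      have h : f.toFun (a + z) ∈ f.toFun '' Z := by
        rw [hfZ, map_add]
        exact ha _ (hfZ ▸ Set.mem_image_of_mem _ hz)
      obtain ⟨y, hy, hyz⟩ := h
      have hzy : (a + z - y) - a + y = z := by abel
      refine ⟨(fun x => ((a + z - y) - a) + x) '' Z, ?_, y, hy, hzy⟩
      exact Finset.mem_coe.2 (Finset.mem_image_of_mem _ (by simp [hyz])))
  obtain ⟨k, hk, rfl⟩ := Finset.mem_image.1 hw
  have hk0 : f.toFun k = 0 := by simpa using hk
  refine ⟨a - k, by simp [hk0], fun z hz => ?_⟩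
  obtain ⟨y, hy, rfl⟩ := hZw hz
  have h : a - k + (k - a + y) = y := by abel
  exact h.symm ▸ hy

/-- An isogeny `f` with `f(Z) = Z` maps the translation stabilizer of `Z` onto itself. -/
lemma IsIsogeny.exists_mem_stabilizer {f : A.Hom} (hf : f.IsIsogeny) {Z : Set A.Pt}
    (hZ : A.IsSubvariety Z) (hirr : IsIrreducible Z) (hfZ : f.toFun '' Z = Z) {s : A.Pt}
    (hs : (fun x => s + x) '' Z = Z) :
    ∃ b, (fun x => b + x) '' Z = Z ∧ f.toFun b = s := by
  obtain ⟨a, rfl⟩ := hf.1 s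
  have hpos : ∀ z ∈ Z, f.toFun a + z ∈ Z := fun z hz => hs ▸ Set.mem_image_of_mem _ hz
  have hneg : ∀ z ∈ Z, f.toFun (-a) + z ∈ Z := by
    intro z hz
    rw [← hs] at hz
    obtain ⟨y, hy, rfl⟩ := hz
    simpa using hy
  obtain ⟨b, hb, hbZ⟩ := hf.exists_ker_translate_subset hZ hirr hfZ hpos
  obtain ⟨c, hc, hcZ⟩ := hf.exists_ker_translate_subset hZ hirr hfZ hneg
  -- `b + c` is a torsion point, so `-b` is a sum of points translating `Z` into itself.
  have hker : ∀ n : ℕ, n • (b + c) ∈ {x : A.Pt | f.toFun x = 0} := fun n => by simp [hb, hc]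
  obtain ⟨n, hn, hn0⟩ : ∃ n : ℕ, 0 < n ∧ n • (b + c) = 0 :=
    isOfFinAddOrder_iff_nsmul_eq_zero.1 (finite_multiples.1 (hf.2.subset (by
      rintro _ ⟨n, rfl⟩
      exact hker n)))
  obtain ⟨n, rfl⟩ := Nat.exists_eq_succ_of_ne_zero hn.ne'
  have hmul : ∀ n : ℕ, ∀ z ∈ Z, n • (b + c) + z ∈ Z := by
    intro n
    induction n with
    | zero => simp
    | succ n ih =>
      intro z hz
      convert hbZ _ (hcZ _ (ih z hz)) using 1
      rw [succ_nsmul]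
      abel
  refine ⟨b, Set.Subset.antisymm ?_ ?_, hb⟩
  · rintro _ ⟨z, hz, rfl⟩
    exact hbZ z hz
  · intro z hz
    refine ⟨c + (n • (b + c) + z), hcZ _ (hmul n z hz), ?_⟩
    have h : b + (c + (n • (b + c) + z)) = (n + 1) • (b + c) + z := by
      rw [succ_nsmul]
      abel
    exact h.trans (by rw [hn0, zero_add])

end AbelianVariety.Hom

/-- Let `A` be an abelian variety over an algebraically closed field of
characteristic zero, `F : A → A` an isogeny, `Z ⊆ A` an irreducible closed
subvariety, and `m ≥ 1` with `Fᵐ(Z) = Z`.  Let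
`G₁ = {a ∈ Ker Fᵐ : a + Z = Z}` be the stabilizer of `Z` in `Ker Fᵐ` under
translation.  If `|G₁| > 1` then the translation stabilizer
`Stab_A(Z) = {a ∈ A : a + Z = Z}` has positive dimension.

(`Stab_A(Z)` is a closed algebraic subgroup of `A`; over an algebraically
closed field of characteristic zero it has positive dimension if and only if
it is infinite, which is how the conclusion is stated here.) -/
theorem stabilizer_positive_dimensional
    {K : Type u} [Field K] [IsAlgClosed K] [CharZero K]
    (A : AbelianVariety K) (F : A.Hom) (hF : F.IsIsogeny)
    (Z : Set A.Pt) (hZ : A.IsSubvariety Z) (hirr : IsIrreducible Z)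
    (m : ℕ) (hm : 1 ≤ m) (hFZ : (F.pow m).toFun '' Z = Z)
    (G1 : Set A.Pt)
    (hG1 : G1 = {a : A.Pt | (F.pow m).toFun a = 0 ∧ (fun x => a + x) '' Z = Z})
    (hG1big : G1.Nontrivial) :
    {a : A.Pt | (fun x => a + x) '' Z = Z}.Infinite := by
  intro hfin
  have hiso := hF.pow m
  set f := F.pow m
  have hmaps : Set.MapsTo f.toFun {a : A.Pt | (fun x => a + x) '' Z = Z}
      {a : A.Pt | (fun x => a + x) '' Z = Z} := by
    intro a ha
    have h : f.toFun '' ((fun x => a + x) '' Z) = (fun x => f.toFun a + x) '' (f.toFun '' Z) := by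
      simp only [Set.image_image, map_add]
    rw [Set.mem_ofPred_eq] at ha
    rw [ha, hFZ] at h
    exact h.symm
  have hsurj : Set.SurjOn f.toFun {a : A.Pt | (fun x => a + x) '' Z = Z}
      {a : A.Pt | (fun x => a + x) '' Z = Z} :=
    fun s hs => hiso.exists_mem_stabilizer hZ hirr hFZ hs
  have hinj := ((hfin.surjOn_iff_bijOn_of_mapsTo hmaps).1 hsurj).injOn
  obtain ⟨a, ha, b, hb, hab⟩ := hG1big
  rw [hG1] at ha hb
  exact hab (hinj ha.2 hb.2 (ha.1.trans hb.1.symm))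
end

section
/- Let K be an algebraically closed field of characteristic zero with automorphism σ, A an abelian variety over K defined over K^σ, F: A → A an endomorphism commuting with σ, and P(T) ∈ ℤ[T] a monic polynomial with P(F) = 0 and no complex root of P a root of unity. Let Δ = Ker(F − σ: A(K) → A(K)). If K is algebraic over the fixed field K^σ, then every element of Δ is a torsion point of A. -/
universe u

/-- `x` is a root of unity. -/
def IsRootOfUnity {M : Type*} [Monoid M] (x : M) : Prop :=
  ∃ n : ℕ, 0 < n ∧ x ^ n = 1

/-- The action on the points of an abelian variety `A` of a field automorphism
`σK` of the base field `K`, where `A` is defined over the fixed field `K^σ` of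
`σK`.  Points are recorded through their coordinates in a fixed embedding of
`A` (the injection `coords`); the induced map `σ` acts coordinatewise through
`σK`, it is additive because the group law of `A` is defined over `K^σ`, and
it is a homeomorphism for the Zariski topology mapping closed subvarieties to
closed subvarieties. -/
structure InducedGaloisAction {K : Type u} [Field K] (A : AbelianVariety K)
    (σK : K ≃+* K) where
  N : ℕ
  /-- the coordinates of a point of `A` in a fixed embedding -/
  coords : A.Pt → Fin N → K
  coords_injective : Function.Injective coords
  /-- the automorphism of `A(K)` induced by `σK` -/
  σ : AddAut A.Pt
  coords_σ : ∀ (x : A.Pt) (i : Fin N), coords (σ x) i = σK (coords x i)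
  isClosed_image_σ : ∀ S : Set A.Pt, IsClosed (⇑σ '' S) ↔ IsClosed S
  isSubvariety_image_σ : ∀ S : Set A.Pt, A.IsSubvariety (⇑σ '' S) ↔ A.IsSubvariety S

/-- The fixed field `K^σ` of a field automorphism `σK` of `K`. -/
def fixedSubfield {K : Type u} [Field K] (σK : K ≃+* K) : Subfield K where
  carrier := {x | σK x = x}
  zero_mem' := by simp
  one_mem' := by simp
  add_mem' := by
    intro a b ha hb
    simp only [Set.mem_setOf_eq] at *
    rw [map_add, ha, hb]
  mul_mem' := by
    intro a b ha hb
    simp only [Set.mem_setOf_eq] at *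
    rw [map_mul, ha, hb]
  neg_mem' := by
    intro a ha
    simp only [Set.mem_setOf_eq] at *
    rw [map_neg, ha]
  inv_mem' := by
    intro a ha
    simp only [Set.mem_setOf_eq] at *
    rw [map_inv₀, ha]

open Polynomial in
/-- If `P ≠ 0` and `Q` are integer polynomials without a common complex root, then the ideal of
`ℤ[X]` that they span contains a nonzero integer. -/
theorem exists_mul_add_mul_eq_C_of_no_common_root {P Q : ℤ[X]} (hP : P ≠ 0)
    (h : ∀ z : ℂ, (P.map (Int.castRingHom ℂ)).IsRoot z → ¬ (Q.map (Int.castRingHom ℂ)).IsRoot z) :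
    ∃ (U V : ℤ[X]) (m : ℤ), m ≠ 0 ∧ U * P + V * Q = C m := by
  have hinj : Function.Injective (Int.castRingHom ℂ) := Int.cast_injective
  have hcop : IsCoprime (P.map (Int.castRingHom ℂ)) (Q.map (Int.castRingHom ℂ)) := by
    rw [isCoprime_iff_aeval_ne_zero_of_isAlgClosed ℂ ℂ]
    intro z
    by_contra! hz
    simp only [coe_aeval_eq_eval] at hz
    exact h z hz.1 hz.2
  have hres : P.resultant Q ≠ 0 := by
    intro h0
    apply resultant_ne_zero _ _ hcop
    rw [natDegree_map_eq_of_injective hinj, natDegree_map_eq_of_injective hinj,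
      resultant_map_map, h0, map_zero]
  by_cases hd : P.natDegree = 0
  · obtain ⟨c, rfl⟩ := natDegree_eq_zero.1 hd
    exact ⟨1, 0, c, by rintro rfl; simp at hP, by simp⟩
  · obtain ⟨p, q, -, -, hpq⟩ := exists_mul_add_mul_eq_C_resultant P Q le_rfl le_rfl (Or.inl hd)
    exact ⟨p, q, _, hres, by rw [← hpq]; ring⟩

/-- An algebraic element over the fixed field of an automorphism has a finite orbit. -/
theorem mem_periodicPts_of_isAlgebraic_fixedSubfield {K : Type u} [Field K] (σK : K ≃+* K)
    {a : K} (ha : IsAlgebraic (fixedSubfield σK) a) : a ∈ Function.periodicPts σK := by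
  obtain ⟨p, hp, hpa⟩ := ha
  have hmaps : Set.MapsTo σK (p.rootSet K) (p.rootSet K) := by
    intro b hb
    rw [Polynomial.mem_rootSet_of_ne hp] at hb ⊢
    let τ : K →ₐ[fixedSubfield σK] K := { (σK : K →+* K) with commutes' := fun x => x.2 }
    change Polynomial.aeval (τ b) p = 0
    rw [Polynomial.aeval_algHom_apply, hb, map_zero]
  have : Finite (p.rootSet K) := p.rootSet_finite K
  obtain ⟨n, hn, hper⟩ := ((hmaps.restrict_inj).2 σK.injective.injOn).mem_periodicPts
    ⟨a, (Polynomial.mem_rootSet_of_ne hp).2 hpa⟩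
  refine ⟨n, hn, ?_⟩
  have := congrArg Subtype.val hper
  rwa [hmaps.iterate_restrict] at this

/-- `K`-points are periodic under the induced action as soon as `K` is algebraic over `K^σ`. -/
theorem InducedGaloisAction.mem_periodicPts {K : Type u} [Field K] {σK : K ≃+* K}
    {A : AbelianVariety K} (act : InducedGaloisAction A σK)
    [Algebra.IsAlgebraic (fixedSubfield σK) K] (x : A.Pt) :
    x ∈ Function.periodicPts act.σ := by
  have hiter : ∀ (n : ℕ) (i : Fin act.N),
      act.coords (act.σ^[n] x) i = σK^[n] (act.coords x i) := by
    intro n i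
    induction n with
    | zero => rfl
    | succ n ih => rw [Function.iterate_succ_apply', Function.iterate_succ_apply', act.coords_σ, ih]
  choose n hn hper using fun i => mem_periodicPts_of_isAlgebraic_fixedSubfield σK
    (Algebra.IsAlgebraic.isAlgebraic (R := fixedSubfield σK) (act.coords x i))
  refine ⟨∏ i, n i, Finset.prod_pos fun i _ => hn i, act.coords_injective (funext fun i => ?_)⟩
  rw [hiter]
  exact (hper i).trans_dvd (Finset.dvd_prod_of_mem n (Finset.mem_univ i))

theorem AbelianVariety.Hom.pow_toFun {K : Type u} [Field K] {A : AbelianVariety K} (F : A.Hom)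
    (n : ℕ) : (F.pow n).toFun = (show AddMonoid.End A.Pt from F.toFun) ^ n := by
  induction n with
  | zero => rfl
  | succ n ih =>
    rw [pow_succ, ← ih]
    rfl

theorem AbelianVariety.Hom.polyApply_eq_aeval {K : Type u} [Field K] {A : AbelianVariety K}
    (F : A.Hom) (P : Polynomial ℤ) (x : A.Pt) :
    F.polyApply P x = Polynomial.aeval (show AddMonoid.End A.Pt from F.toFun) P x := by
  rw [Polynomial.aeval_eq_sum_range, polyApply, Polynomial.sum_over_range _ (by simp)]
  simp only [pow_toFun]
  let ev : AddMonoid.End A.Pt →+ A.Pt :=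
    { toFun := fun g => g x, map_zero' := rfl, map_add' := fun _ _ => rfl }
  symm
  exact map_sum ev (fun i => P.coeff i • (show AddMonoid.End A.Pt from F.toFun) ^ i) _

/-- Let `K` be an algebraically closed field of characteristic zero with a
field automorphism `σK`, `A` an abelian variety over `K` defined over the
fixed field `K^σ` (so that `σK` induces an automorphism `σ` of `A(K)`),
`F : A → A` an algebraic endomorphism commuting with `σ`, and `P(T) ∈ ℤ[T]` a
monic polynomial with `P(F) = 0` none of whose complex roots is a root of
unity.  Let `Δ = Ker (F − σ : A(K) → A(K))`.  If `K` is algebraic over the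
fixed field `K^σ`, then every element of `Δ` is a torsion point of `A`. -/
theorem delta_is_torsion
    {K : Type u} [Field K] [IsAlgClosed K] [CharZero K]
    (σK : K ≃+* K) (A : AbelianVariety K) (act : InducedGaloisAction A σK)
    (halg : Algebra.IsAlgebraic (fixedSubfield σK) K)
    (F : A.Hom) (hcomm : ∀ x : A.Pt, F.toFun (act.σ x) = act.σ (F.toFun x))
    (P : Polynomial ℤ) (hP : P.Monic)
    (hPF : ∀ x : A.Pt, F.polyApply P x = 0)
    (hroots : ∀ z : ℂ, (P.map (Int.castRingHom ℂ)).IsRoot z → ¬ IsRootOfUnity z) :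
    ∀ x : A.Pt, F.toFun x - act.σ x = 0 → IsOfFinAddOrder x := by
  intro x hx
  rw [sub_eq_zero] at hx
  obtain ⟨n, hn, hper⟩ := act.mem_periodicPts x
  let f : AddMonoid.End A.Pt := F.toFun
  have hfx : (f ^ n) x = x := by
    rw [AddMonoid.End.coe_pow]
    have hsemi : Function.Commute f act.σ := hcomm
    exact (hsemi.iterate_eq_of_map_eq n hx).trans hper
  obtain ⟨U, V, m, hm, hUV⟩ := exists_mul_add_mul_eq_C_of_no_common_root
    (Q := Polynomial.X ^ n - 1) hP.ne_zero fun z hz h => hroots z hz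
      ⟨n, hn, by simpa [sub_eq_zero] using h⟩
  have hPx : Polynomial.aeval f P x = 0 := by
    rw [← hPF x, F.polyApply_eq_aeval]
  have hQx : Polynomial.aeval f (Polynomial.X ^ n - 1 : Polynomial ℤ) x = 0 := by
    rw [map_sub, map_pow, Polynomial.aeval_X, map_one]
    exact sub_eq_zero.2 hfx
  have hmx : m • x = 0 := by
    have := DFunLike.congr_fun (congrArg (Polynomial.aeval f) hUV) x
    rw [map_add, map_mul, map_mul, Polynomial.aeval_C] at this
    calc m • x = Polynomial.aeval f U (Polynomial.aeval f P x)
          + Polynomial.aeval f V (Polynomial.aeval f (Polynomial.X ^ n - 1) x) := this.symm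
      _ = 0 := by rw [hPx, hQx, map_zero, map_zero, add_zero]
  exact isOfFinAddOrder_iff_zsmul_eq_zero.2 ⟨m, hm, hmx⟩
end

section
/- Let A be an abelian variety over an algebraically closed field of characteristic zero and F: A → A an endomorphism satisfying P(F) = 0 for a monic polynomial P(T) ∈ ℤ[T] none of whose complex roots is a root of unity. Then for every integer m ≥ 1, the endomorphism F^m − id of A is an isogeny. -/
universe u

open Polynomial in
/-- If no complex root of an integer polynomial `P` is a root of unity, then the ideal generated by
`P` and `X ^ m - 1` contains a nonzero integer constant. -/
theorem exists_mul_add_mul_X_pow_sub_one_eq_C {P : ℤ[X]}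
    (hroots : ∀ z : ℂ, (P.map (Int.castRingHom ℂ)).IsRoot z → ¬ IsRootOfUnity z)
    {m : ℕ} (hm : 1 ≤ m) :
    ∃ (a b : ℤ[X]) (N : ℤ), N ≠ 0 ∧ P * a + (X ^ m - 1) * b = C N := by
  have hcop : IsCoprime (P.map (Int.castRingHom ℂ))
      ((X ^ m - 1 : ℤ[X]).map (Int.castRingHom ℂ)) := by
    rw [isCoprime_iff_aeval_ne_zero_of_isAlgClosed ℂ ℂ]
    intro z
    by_contra! h
    refine hroots z (by simpa [IsRoot] using h.1) ⟨m, hm, ?_⟩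
    simpa [sub_eq_zero] using h.2
  have hdeg : (X ^ m - 1 : ℤ[X]).natDegree = m := natDegree_X_pow_sub_C (r := (1 : ℤ))
  obtain ⟨a, b, -, -, hab⟩ := exists_mul_add_mul_eq_C_resultant P (X ^ m - 1) le_rfl le_rfl
    (Or.inr (by omega))
  refine ⟨a, b, _, fun h => resultant_ne_zero _ _ hcop ?_, hab⟩
  rw [natDegree_map_eq_of_injective (Int.castRingHom ℂ).injective_int,
    natDegree_map_eq_of_injective (Int.castRingHom ℂ).injective_int, resultant_map_map, h, map_zero]

namespace AbelianVariety.Hom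

variable {K : Type u} [Field K] {A : AbelianVariety K}

theorem pow_toFun_s12 (f : A.Hom) (n : ℕ) (x : A.Pt) :
    (f.pow n).toFun x = (f.toFun.toIntLinearMap ^ n : Module.End ℤ A.Pt) x := by
  induction n generalizing x with
  | zero => rfl
  | succ n ih => exact ih _

theorem polyApply_eq_aeval_s12 (f : A.Hom) (P : Polynomial ℤ) (x : A.Pt) :
    f.polyApply P x = Polynomial.aeval (f.toFun.toIntLinearMap : Module.End ℤ A.Pt) P x := by
  simp [polyApply, Polynomial.aeval_eq_sum_range, Polynomial.sum_over_range, pow_toFun_s12]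

end AbelianVariety.Hom

namespace AbelianVariety

variable {K : Type u} [Field K]

theorem zsmul_surjective (A : AbelianVariety K) {N : ℤ} (hN : N ≠ 0) (x : A.Pt) :
    ∃ y : A.Pt, N • y = x := by
  obtain ⟨y, hy⟩ := A.ptDivisible N.natAbs (Int.natAbs_pos.mpr hN) x
  rcases Int.natAbs_eq N with h | h
  · exact ⟨y, by rw [h, natCast_zsmul, hy]⟩
  · exact ⟨-y, by rw [h, neg_zsmul, natCast_zsmul, smul_neg, neg_neg, hy]⟩

theorem finite_zsmul_eq_zero (A : AbelianVariety K) {N : ℤ} (hN : N ≠ 0) :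
    {x : A.Pt | N • x = 0}.Finite := by
  refine (A.ptTorsionFinite N.natAbs (Int.natAbs_pos.mpr hN)).subset fun x hx => ?_
  simpa using hx

end AbelianVariety

/-- Let `A` be an abelian variety over an algebraically closed field of
characteristic zero and `F : A → A` an algebraic endomorphism satisfying
`P(F) = 0` for a monic polynomial `P(T) ∈ ℤ[T]` none of whose complex roots is
a root of unity.  Then for every integer `m ≥ 1` the endomorphism `Fᵐ − id`
of `A` is an isogeny, i.e. it is surjective with finite kernel. -/
theorem pow_sub_id_is_isogeny
    {K : Type u} [Field K] [IsAlgClosed K] [CharZero K]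
    (A : AbelianVariety K) (F : A.Hom)
    (P : Polynomial ℤ) (hP : P.Monic)
    (hPF : ∀ x : A.Pt, F.polyApply P x = 0)
    (hroots : ∀ z : ℂ, (P.map (Int.castRingHom ℂ)).IsRoot z → ¬ IsRootOfUnity z)
    (m : ℕ) (hm : 1 ≤ m) :
    Function.Surjective (fun x : A.Pt => (F.pow m).toFun x - x) ∧
    {x : A.Pt | (F.pow m).toFun x - x = 0}.Finite := by
  set φ : Module.End ℤ A.Pt := F.toFun.toIntLinearMap with hφ
  obtain ⟨a, b, N, hN, hab⟩ := exists_mul_add_mul_X_pow_sub_one_eq_C hroots hm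
  have hPφ : Polynomial.aeval φ P = 0 :=
    LinearMap.ext fun x => by rw [← F.polyApply_eq_aeval_s12, hPF, LinearMap.zero_apply]
  have hright : (φ ^ m - 1) * Polynomial.aeval φ b = N • (1 : Module.End ℤ A.Pt) := by
    simpa [hPφ, Algebra.smul_def] using congrArg (Polynomial.aeval φ) hab
  have hleft : Polynomial.aeval φ b * (φ ^ m - 1) = N • (1 : Module.End ℤ A.Pt) := by
    simpa [hPφ, Algebra.smul_def] using congrArg (Polynomial.aeval φ)
      ((congrArg (P * a + ·) (mul_comm b (Polynomial.X ^ m - 1))).trans hab)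
  have hpow (x : A.Pt) : (F.pow m).toFun x - x = (φ ^ m - 1) x := by
    rw [F.pow_toFun_s12, LinearMap.sub_apply, Module.End.one_apply]
  simp only [hpow]
  constructor
  · intro x
    obtain ⟨y, rfl⟩ := A.zsmul_surjective hN x
    exact ⟨Polynomial.aeval φ b y, LinearMap.congr_fun hright y⟩
  · refine (A.finite_zsmul_eq_zero hN).subset fun x hx => ?_
    have h := LinearMap.congr_fun hleft x
    rw [Module.End.mul_apply, show (φ ^ m - 1) x = 0 from hx, map_zero] at h
    exact h.symm
end
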